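/- arXiv:2103.14309 — 3 statements merged into one kernel-verified Lean document; each statement's English description precedes it below -/
import Mathlib

section
/- Let f : ℝ/ℤ → ℝ/ℤ be a continuous map preserving the Haar (Lebesgue) probability measure on the circle and having no periodic points (i.e., f^n(x) ≠ x for every x and every n ≥ 1). Then f is an irrational rotation: there exists an irrational α ∈ ℝ such that f(x) = x + α (mod 1) for all x. -/
open MeasureTheory Set Filter Topology

noncomputable section

/-- A continuous real map which never takes the value `x + c` at `x` and lies below `x + c`
somewhere lies below it everywhere. -/
lemma Continuous.forall_lt_add_of_ne {G : ℝ → ℝ} (hG : Continuous G) {c : ℝ}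
    (hne : ∀ x, G x ≠ x + c) {y : ℝ} (hy : G y < y + c) (x : ℝ) : G x < x + c := by
  by_contra! hx
  obtain ⟨z, hz⟩ := mem_range_of_exists_le_of_exists_ge (f := fun x => G x - x)
    (hG.sub continuous_id) ⟨y, (by linarith : G y - y ≤ c)⟩ ⟨x, (by linarith : c ≤ G x - x)⟩
  exact hne z (by linarith)

/-- A continuous real map which never takes the value `x + c` at `x` and lies above `x + c`
somewhere lies above it everywhere. -/
lemma Continuous.forall_add_lt_of_ne {G : ℝ → ℝ} (hG : Continuous G) {c : ℝ}
    (hne : ∀ x, G x ≠ x + c) {y : ℝ} (hy : y + c < G y) (x : ℝ) : x + c < G x :=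
  (hne x).lt_or_gt.resolve_left fun hx => hy.not_gt (hG.forall_lt_add_of_ne hne hx y)

/-- The iterates of a continuous real map without fixed points lying above the diagonal are
unbounded. -/
lemma Continuous.exists_lt_iterate {G : ℝ → ℝ} (hG : Continuous G) (hlt : ∀ x, x < G x)
    (x c : ℝ) : ∃ j : ℕ, c < G^[j] x := by
  by_contra! h
  have hmono : Monotone fun j : ℕ => G^[j] x := monotone_nat_of_le_succ fun j => by
    rw [Function.iterate_succ_apply']
    exact (hlt _).le
  have hlim := tendsto_atTop_ciSup hmono ⟨c, by rintro _ ⟨j, rfl⟩; exact h j⟩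
  exact (hlt _).ne' (isFixedPt_of_tendsto_iterate hlim hG.continuousAt)

/-- A gap `(a, b)` of a set invariant under `G` and under `x ↦ x - 1` cannot contain a point
together with its image, if `G` moves every point up and no iterate of `G` moves a point by `1`. -/
lemma notMem_gap_of_lt {G : ℝ → ℝ} (hG : Continuous G) (hlt : ∀ x, x < G x)
    (hone : ∀ j ≠ 0, ∀ x, G^[j] x ≠ x + 1) {K : Set ℝ} (hK : MapsTo G K K)
    (hK1 : ∀ x ∈ K, x - 1 ∈ K) {a b : ℝ} (ha : a ∈ K) (hb : b ∈ K)
    (hgap : ∀ x ∈ K, x ≤ a ∨ b ≤ x) {y : ℝ} (hy : y ∈ Ioo a b) : G y ∉ Ioo a b := by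
  intro hGy
  have hex : ∃ j : ℕ, a + 1 < G^[j] a := hG.exists_lt_iterate hlt a (a + 1)
  classical
  obtain ⟨j, hj⟩ : ∃ j, Nat.find hex = j + 1 := Nat.exists_eq_succ_of_ne_zero fun h0 => by
    have := Nat.find_spec hex
    rw [h0, Function.iterate_zero, id] at this
    linarith
  have hup : ∀ x, x + 1 < G^[j + 1] x :=
    (hG.iterate _).forall_add_lt_of_ne (hone _ j.succ_ne_zero) (hj ▸ Nat.find_spec hex)
  have hdown : ∀ x, G^[j] x < x + 1 := by
    rcases eq_or_ne j 0 with rfl | hj0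
    · intro x
      simp
    · refine (hG.iterate _).forall_lt_add_of_ne (hone j hj0) (y := a) ?_
      exact lt_of_le_of_ne (not_lt.1 (Nat.find_min hex (by omega))) (hone j hj0 a)
  have hGa : b ≤ G a := (hgap _ (hK ha)).resolve_left (hlt a).not_ge
  obtain ⟨z, hz, hzb⟩ := intermediate_value_Icc' hy.1.le hG.continuousOn ⟨hGy.2.le, hGa⟩
  have hle : G^[j] b - 1 ≤ a :=
    (hgap _ (hK1 _ (hK.iterate j hb))).resolve_right (by linarith [hdown b])
  have := hup z
  rw [Function.iterate_succ_apply, hzb] at this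
  linarith [hz.1]

/-- A gap `(a, b)` of a set invariant under `G` and under integer translations cannot contain a
point together with its image, if no iterate of `G` moves a point by an integer. -/
lemma notMem_gap {G : ℝ → ℝ} (hG : Continuous G)
    (hne : ∀ j ≠ 0, ∀ x, ∀ m : ℤ, G^[j] x ≠ x + m) {K : Set ℝ} (hK : MapsTo G K K)
    (hK1 : ∀ x ∈ K, ∀ m : ℤ, x + m ∈ K) {a b : ℝ} (ha : a ∈ K) (hb : b ∈ K)
    (hgap : ∀ x ∈ K, x ≤ a ∨ b ≤ x) {y : ℝ} (hy : y ∈ Ioo a b) : G y ∉ Ioo a b := by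
  have hid : ∀ x, G x ≠ x + 0 := fun x => by simpa using hne 1 one_ne_zero x 0
  rcases (hid y).lt_or_gt with h | h
  · have hconj (j : ℕ) (x : ℝ) : (fun x => -G (-x))^[j] x = -G^[j] (-x) := by
      induction j generalizing x with
      | zero => simp
      | succ j ih => simp [ih]
    have hlt := hG.forall_lt_add_of_ne hid h
    intro hGy
    refine notMem_gap_of_lt (G := fun x => -G (-x)) (K := Neg.neg ⁻¹' K) (a := -b) (b := -a)
      (y := -y) (by fun_prop) (fun x => by linarith [hlt (-x)]) (fun j hj x => ?_)
      (fun x hx => ?_) (fun x hx => ?_) (by simpa) (by simpa) (fun x hx => ?_)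
      ⟨by linarith [hy.2], by linarith [hy.1]⟩ ?_
    · rw [hconj]
      intro h'
      refine hne j hj (-x) (-1) ?_
      push_cast
      linarith
    · simpa using hK hx
    · have := hK1 _ hx 1
      simp only [mem_preimage] at this ⊢
      convert this using 1
      push_cast
      ring
    · rcases hgap _ hx with h' | h'
      · right; linarith
      · left; linarith
    · simpa using hGy.symm
  · refine notMem_gap_of_lt hG ?_ (fun j hj x => by simpa using hne j hj x 1) hK
      (fun x hx => by simpa [sub_eq_add_neg] using hK1 x hx (-1)) ha hb hgap hy
    simpa using hG.forall_add_lt_of_ne hid h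

/-- A nonempty closed set of reals invariant under integer translations is either the whole line
or has a bounded gap. -/
lemma IsClosed.exists_gap {K : Set ℝ} (hK : IsClosed K) (hne : K.Nonempty)
    (hK1 : ∀ x ∈ K, ∀ m : ℤ, x + m ∈ K) {z : ℝ} (hz : z ∉ K) :
    ∃ a ∈ K, ∃ b ∈ K, a < b ∧ ∀ x ∈ K, x ≤ a ∨ b ≤ x := by
  obtain ⟨w, hw⟩ := hne
  have hl : (K ∩ Iic z).Nonempty :=
    ⟨w + (⌊z - w⌋ : ℤ), hK1 _ hw _, by simp only [mem_Iic]; linarith [Int.floor_le (z - w)]⟩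
  have hr : (K ∩ Ici z).Nonempty :=
    ⟨w + (⌈z - w⌉ : ℤ), hK1 _ hw _, by simp only [mem_Ici]; linarith [Int.le_ceil (z - w)]⟩
  have hlb : BddAbove (K ∩ Iic z) := ⟨z, fun x hx => hx.2⟩
  have hrb : BddBelow (K ∩ Ici z) := ⟨z, fun x hx => hx.2⟩
  have ha := (hK.inter isClosed_Iic).csSup_mem hl hlb
  have hb := (hK.inter isClosed_Ici).csInf_mem hr hrb
  refine ⟨_, ha.1, _, hb.1, ?_, fun x hx => ?_⟩
  · exact (lt_of_le_of_ne ha.2 fun h => hz (by rw [← h]; exact ha.1)).trans_le hb.2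
  · rcases le_total x z with h | h
    · exact .inl (le_csSup hlb ⟨hx, h⟩)
    · exact .inr (csInf_le hrb ⟨hx, h⟩)

/-- A continuous circle map without fixed points has the form `x ↦ x + φ x` for a continuous
real function `φ`. -/
lemma UnitAddCircle.exists_displacement {f : UnitAddCircle → UnitAddCircle} (hf : Continuous f)
    (hfix : ∀ x, f x ≠ x) :
    ∃ φ : UnitAddCircle → ℝ, Continuous φ ∧ ∀ x, f x = x + (φ x : UnitAddCircle) := by
  refine ⟨fun x => AddCircle.equivIco 1 0 (f x - x), ?_, fun x => ?_⟩
  · refine continuous_iff_continuousAt.2 fun x => ?_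
    have h0 : f x - x ≠ ((0 : ℝ) : UnitAddCircle) := by
      simpa [sub_eq_zero] using hfix x
    exact continuousAt_subtype_val.comp
      ((AddCircle.continuousAt_equivIco 1 0 h0).comp (f := fun x => f x - x)
        (hf.sub continuous_id).continuousAt)
  · rw [AddCircle.coe_equivIco]
    abel

lemma UnitAddCircle.coe_add_intCast (x : ℝ) (m : ℤ) :
    ((x + m : ℝ) : UnitAddCircle) = x := by
  rw [AddCircle.coe_add, add_eq_left, AddCircle.coe_eq_zero_iff]
  exact ⟨m, zsmul_one m⟩

lemma UnitAddCircle.exists_eq_add_intCast {x y : ℝ} (h : (x : UnitAddCircle) = y) :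
    ∃ m : ℤ, x = y + m := by
  rw [← sub_eq_zero, ← AddCircle.coe_sub, AddCircle.coe_eq_zero_iff] at h
  obtain ⟨m, hm⟩ := h
  rw [zsmul_one] at hm
  exact ⟨m, by linarith⟩

/-- Order on a single orbit of a lift without periodic points is preserved by the lift. -/
lemma lift_lt_of_orbit_lt {F : ℝ → ℝ} (hF : Continuous F)
    (hdeg : ∀ x, ∀ m : ℤ, F (x + m) = F x + m)
    (hne : ∀ n ≠ 0, ∀ x, ∀ m : ℤ, F^[n] x ≠ x + m) (y : ℝ) {n k : ℕ} {m l : ℤ}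
    (h : F^[n] y + m < F^[k] y + l) : F (F^[n] y + m) < F (F^[k] y + l) := by
  have hlt (d : ℕ) (j : ℤ) (z w : ℝ) (hz : F^[d] z < z + j) : F^[d] w < w + j := by
    rcases eq_or_ne d 0 with rfl | hd
    · simpa using hz
    · exact (hF.iterate d).forall_lt_add_of_ne (fun x => hne d hd x j) hz w
  have hgt (d : ℕ) (j : ℤ) (z w : ℝ) (hz : z + j < F^[d] z) : w + j < F^[d] w := by
    rcases eq_or_ne d 0 with rfl | hd
    · simpa using hz
    · exact (hF.iterate d).forall_add_lt_of_ne (fun x => hne d hd x j) hz w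
  rw [hdeg, hdeg]
  rcases le_total k n with hkn | hkn
  · obtain ⟨d, rfl⟩ := Nat.exists_eq_add_of_le' hkn
    rw [Function.iterate_add_apply] at h ⊢
    rw [← Function.iterate_succ_apply' F d, Function.iterate_succ_apply]
    have := hlt d (l - m) (F^[k] y) (F (F^[k] y)) (by push_cast; linarith)
    push_cast at this
    linarith
  · obtain ⟨d, rfl⟩ := Nat.exists_eq_add_of_le' hkn
    rw [Function.iterate_add_apply] at h ⊢
    rw [← Function.iterate_succ_apply' F d, Function.iterate_succ_apply]
    have := hgt d (m - l) (F^[n] y) (F (F^[n] y)) (by push_cast; linarith)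
    push_cast at this
    linarith

/-- A continuous map that is monotone on a dense set is monotone. -/
lemma Continuous.monotone_of_dense {F : ℝ → ℝ} (hF : Continuous F) {s : Set ℝ} (hs : Dense s)
    (hmono : MonotoneOn F s) : Monotone F := by
  refine monotone_iff_forall_lt.2 fun x y hxy => ?_
  by_contra! h
  obtain ⟨c, hc, hc'⟩ := exists_between h
  obtain ⟨d, hd, hd'⟩ := exists_between hxy
  obtain ⟨u, ⟨hu, hud⟩, hus⟩ := hs.inter_open_nonempty _
    ((isOpen_Ioi.preimage hF).inter isOpen_Iio) ⟨x, hc', hd⟩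
  obtain ⟨v, ⟨hv, hvd⟩, hvs⟩ := hs.inter_open_nonempty _
    ((isOpen_Iio.preimage hF).inter isOpen_Ioi) ⟨y, hc, hd'⟩
  simp only [mem_preimage, mem_Ioi, mem_Iio] at hu hv hud hvd
  linarith [hmono hus hvs (by linarith)]

/-- A monotone lift of a measure preserving circle map does not contract short intervals. -/
lemma sub_le_lift_sub {f : UnitAddCircle → UnitAddCircle}
    (hpres : ∀ A : Set UnitAddCircle, MeasurableSet A → volume (f ⁻¹' A) = volume A)
    {F : ℝ → ℝ} (hlift : ∀ x : ℝ, (F x : UnitAddCircle) = f x) (hmono : Monotone F)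
    {x y : ℝ} (hxy : x ≤ y) (hy : y ≤ x + 1) : y - x ≤ F y - F x := by
  have hsub : Metric.closedBall (((x + y) / 2 : ℝ) : UnitAddCircle) ((y - x) / 2) ⊆
      f ⁻¹' Metric.closedBall (((F x + F y) / 2 : ℝ) : UnitAddCircle) ((F y - F x) / 2) := by
    intro z hz
    induction z using QuotientAddGroup.induction_on with
    | H z =>
    have hz' : z ∈ ((↑) : ℝ → UnitAddCircle) ⁻¹'
      Metric.closedBall (((x + y) / 2 : ℝ) : UnitAddCircle) ((y - x) / 2) := hz
    rw [AddCircle.coe_real_preimage_closedBall_eq_iUnion, mem_iUnion] at hz'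
    obtain ⟨m, hm⟩ := hz'
    rw [Metric.mem_closedBall, Real.dist_eq, abs_le, zsmul_one] at hm
    have hzm : ((z - m : ℝ) : UnitAddCircle) = z := by
      rw [← UnitAddCircle.coe_add_intCast (z - m) m, sub_add_cancel]
    have hfz : f (z : UnitAddCircle) = (F (z - m) : UnitAddCircle) := by rw [hlift, hzm]
    rw [mem_preimage]
    erw [hfz]
    rw [Metric.mem_closedBall, dist_eq_norm, ← AddCircle.coe_sub]
    refine QuotientAddGroup.norm_mk_le_norm.trans ?_
    rw [Real.norm_eq_abs, abs_le]
    have h1 : F x ≤ F (z - m) := hmono (by linarith)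
    have h2 : F (z - m) ≤ F y := hmono (by linarith)
    constructor <;> linarith
  have hvol := measure_mono (μ := volume) hsub
  rw [hpres _ Metric.isClosed_closedBall.measurableSet, AddCircle.volume_closedBall,
    AddCircle.volume_closedBall, ENNReal.ofReal_le_ofReal_iff
      (le_min zero_le_one (by linarith [hmono hxy]))] at hvol
  have h1 : y - x ≤ min 1 (2 * ((y - x) / 2)) := le_min (by linarith) (by linarith)
  linarith [h1.trans (hvol.trans (min_le_right _ _))]

/-- The lifted orbits of a lift of a measure preserving circle map without periodic points are
dense. -/
lemma dense_lifted_orbit {f : UnitAddCircle → UnitAddCircle} (hf : MeasurePreserving f)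
    {F : ℝ → ℝ} (hF : Continuous F) (hlift : ∀ x : ℝ, (F x : UnitAddCircle) = f x)
    (hdeg : ∀ x, ∀ m : ℤ, F (x + m) = F x + m)
    (hper : ∀ (x : UnitAddCircle) (n : ℕ), 1 ≤ n → f^[n] x ≠ x) (x₀ : ℝ) :
    Dense (range fun p : ℕ × ℤ => F^[p.1] x₀ + p.2) := by
  set O := range fun p : ℕ × ℤ => F^[p.1] x₀ + p.2
  have hOF : MapsTo F O O := by
    rintro _ ⟨⟨n, m⟩, rfl⟩
    exact ⟨(n + 1, m), by simp only [hdeg, Function.iterate_succ_apply']⟩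
  have hO1 (m : ℤ) : MapsTo (fun x : ℝ => x + m) O O := by
    rintro _ ⟨⟨n, k⟩, rfl⟩
    exact ⟨(n, k + m), by push_cast; ring⟩
  have hKF : MapsTo F (closure O) (closure O) := hOF.closure hF
  have hK1 : ∀ x ∈ closure O, ∀ m : ℤ, x + m ∈ closure O := fun x hx m =>
    (hO1 m).closure (by fun_prop) hx
  by_contra hd
  obtain ⟨z, hz⟩ := not_forall.1 hd
  obtain ⟨a, ha, b, hb, hab, hgap⟩ :=
    isClosed_closure.exists_gap (range_nonempty _).closure hK1 hz
  have hopen : IsOpen (((↑) : ℝ → UnitAddCircle) '' Ioo a b) :=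
    QuotientAddGroup.isOpenMap_coe _ isOpen_Ioo
  obtain ⟨_, ⟨y, hy, rfl⟩, n, hn, w, hw, hwn⟩ := hf.conservative.exists_mem_iterate_mem
    hopen.measurableSet.nullMeasurableSet
    (hopen.measure_ne_zero volume ((nonempty_Ioo.2 hab).image _))
  have hiter (k : ℕ) (x : ℝ) : ((F^[k] x : ℝ) : UnitAddCircle) = f^[k] x :=
    Function.Semiconj.iterate_right (f := ((↑) : ℝ → UnitAddCircle)) hlift k x
  rw [← hiter] at hwn
  obtain ⟨m, hm⟩ := UnitAddCircle.exists_eq_add_intCast hwn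
  set G : ℝ → ℝ := fun x => F^[n] x + m
  have hGlift (x : ℝ) : (G x : UnitAddCircle) = f^[n] x := by
    rw [UnitAddCircle.coe_add_intCast, hiter]
  refine notMem_gap (G := G) ((hF.iterate n).add continuous_const) (fun j hj x l h => ?_)
    (fun x hx => hK1 _ (hKF.iterate n hx) m) hK1 ha hb hgap hy
    (by rw [show G y = w from hm.symm]; exact hw)
  have hGj : ((G^[j] x : ℝ) : UnitAddCircle) = (f^[n])^[j] x :=
    Function.Semiconj.iterate_right (f := ((↑) : ℝ → UnitAddCircle)) hGlift j x
  rw [h, UnitAddCircle.coe_add_intCast, ← Function.iterate_mul] at hGj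
  exact hper x _ (Nat.one_le_iff_ne_zero.2 (mul_ne_zero hn hj)) hGj.symm

theorem measurePreserving_no_periodic_is_irrational_rotation
    (f : UnitAddCircle → UnitAddCircle) (hf : Continuous f)
    (hpres : ∀ A : Set UnitAddCircle, MeasurableSet A → volume (f ⁻¹' A) = volume A)
    (hper : ∀ (x : UnitAddCircle) (n : ℕ), 1 ≤ n → f^[n] x ≠ x) :
    ∃ α : ℝ, Irrational α ∧ ∀ x : UnitAddCircle, f x = x + (α : UnitAddCircle) := by
  obtain ⟨φ, hφ, hfφ⟩ := UnitAddCircle.exists_displacement hf fun x => hper x 1 le_rfl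
  set F : ℝ → ℝ := fun x => x + φ x with hFdef
  have hF : Continuous F := continuous_id.add (hφ.comp (AddCircle.continuous_mk' 1))
  have hlift (x : ℝ) : (F x : UnitAddCircle) = f x := by
    rw [hfφ, AddCircle.coe_add]
  have hdeg (x : ℝ) (m : ℤ) : F (x + m) = F x + m := by
    simp only [hFdef, UnitAddCircle.coe_add_intCast]
    ring
  have hne : ∀ n ≠ 0, ∀ x, ∀ m : ℤ, F^[n] x ≠ x + m := by
    intro n hn x m h
    have hiter : ((F^[n] x : ℝ) : UnitAddCircle) = f^[n] x :=
      Function.Semiconj.iterate_right (f := ((↑) : ℝ → UnitAddCircle)) hlift n x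
    rw [h, UnitAddCircle.coe_add_intCast] at hiter
    exact hper x n (Nat.one_le_iff_ne_zero.2 hn) hiter.symm
  have hmp : MeasurePreserving f :=
    ⟨hf.measurable, Measure.ext fun A hA => by rw [Measure.map_apply hf.measurable hA, hpres A hA]⟩
  have hmono : Monotone F := by
    refine hF.monotone_of_dense (dense_lifted_orbit hmp hF hlift hdeg hper 0) ?_
    rintro _ ⟨⟨n, m⟩, rfl⟩ _ ⟨⟨k, l⟩, rfl⟩ h
    rcases h.eq_or_lt with h | h
    · exact (congrArg F h).le
    · exact (lift_lt_of_orbit_lt hF hdeg hne 0 h).le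
  have hrot : ∀ x : UnitAddCircle, f x = x + (φ 0 : UnitAddCircle) := by
    intro x
    obtain ⟨t, ht, rfl⟩ : ∃ t ∈ Ico (0 : ℝ) 1, (t : UnitAddCircle) = x :=
      ⟨AddCircle.equivIco 1 0 x, by simpa using (AddCircle.equivIco 1 0 x).2,
        AddCircle.coe_equivIco⟩
    have h1 := sub_le_lift_sub hpres hlift hmono ht.1 (by linarith [ht.2])
    have h2 := sub_le_lift_sub hpres hlift hmono ht.2.le (by linarith [ht.1])
    have h3 := hdeg 0 1
    have h0 : F 0 = φ 0 := by simp [hFdef]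
    rw [Int.cast_one, zero_add] at h3
    rw [← hlift, ← AddCircle.coe_add]
    congr 1
    linarith
  refine ⟨φ 0, ?_, hrot⟩
  rintro ⟨q, hq⟩
  have hiter (n : ℕ) : f^[n] 0 = n • (φ 0 : UnitAddCircle) := by
    induction n with
    | zero => simp
    | succ n ih => rw [Function.iterate_succ_apply', ih, hrot, succ_nsmul]
  refine hper 0 q.den q.pos ?_
  rw [hiter, ← AddCircle.coe_nsmul, ← hq, nsmul_eq_mul]
  have : (q.den : ℝ) * q = 0 + (q.num : ℤ) := by
    rw [zero_add]
    exact_mod_cast q.den_mul_eq_num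
  rw [this, UnitAddCircle.coe_add_intCast, AddCircle.coe_zero]
end
end

section
/- Let f : ℝ/ℤ → ℝ/ℤ be a continuous map preserving the Haar (Lebesgue) probability measure on the circle and having no periodic points (i.e., f^n(x) ≠ x for every x and every n ≥ 1). Then f is injective. -/
open MeasureTheory Set Filter Topology

noncomputable section

/-- A continuous circle-valued map avoiding `0` lifts to a continuous map into `(0, 1)`. -/
theorem exists_continuous_lift_of_ne_zero {X : Type*} [TopologicalSpace X]
    {φ : X → UnitAddCircle} (hφ : Continuous φ) (h0 : ∀ x, φ x ≠ 0) :
    ∃ g : X → ℝ, Continuous g ∧ ∀ x, 0 < g x ∧ g x < 1 ∧ (g x : UnitAddCircle) = φ x := by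
  refine ⟨fun x => (AddCircle.equivIco 1 0 (φ x) : ℝ), ?_, fun x => ?_⟩
  · refine continuous_subtype_val.comp (continuous_iff_continuousAt.2 fun x => ?_)
    exact (AddCircle.continuousAt_equivIco (1 : ℝ) 0 (by simpa using h0 x)).comp hφ.continuousAt
  · have hm := (AddCircle.equivIco (1 : ℝ) 0 (φ x)).2
    have hc : (((AddCircle.equivIco (1 : ℝ) 0 (φ x) : ℝ)) : UnitAddCircle) = φ x :=
      AddCircle.coe_equivIco
    refine ⟨lt_of_le_of_ne hm.1 fun h => h0 x ?_, by simpa using hm.2, hc⟩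
    rw [← hc]
    exact (congrArg _ h.symm).trans (AddCircle.coe_zero 1)

/-- A continuous integer-valued real function on a preconnected space is constant. -/
theorem eq_of_continuous_of_coe_eq_zero {X : Type*} [TopologicalSpace X] [PreconnectedSpace X]
    {u : X → ℝ} (hu : Continuous u) (h : ∀ x, (u x : UnitAddCircle) = 0) (x y : X) :
    u x = u y := by
  have h' : ∀ x, ∃ n : ℤ, (n : ℝ) = u x := fun x => by
    simpa using (AddCircle.coe_eq_zero_iff (1 : ℝ)).1 (h x)
  choose z hz using h'
  have hzc : Continuous z := by
    rw [Int.isClosedEmbedding_coe_real.isInducing.continuous_iff]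
    convert hu using 1
    exact funext hz
  rw [← hz, ← hz, PreconnectedSpace.constant inferInstance hzc (x := x) (y := y)]

theorem eq_of_coe_eq_coe_of_abs_sub_lt_one {a b : ℝ}
    (h : (a : UnitAddCircle) = b) (hab : |a - b| < 1) : a = b := by
  have h0 : ((a - b : ℝ) : UnitAddCircle) = 0 := by
    rw [AddCircle.coe_sub, h, sub_self]
  obtain ⟨n, hn⟩ := (AddCircle.coe_eq_zero_iff (1 : ℝ)).1 h0
  have hn' : (n : ℝ) = a - b := by simpa using hn
  rw [← hn'] at hab
  have : |n| < 1 := by exact_mod_cast hab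
  rw [Int.abs_lt_one_iff] at this
  subst this
  simp at hn'
  linarith

/-- For a circle map without periodic points, the displacements of all iterates have
continuous lifts to `(0, 1)`. -/
theorem exists_displacement {f : UnitAddCircle → UnitAddCircle} (hf : Continuous f)
    (hper : ∀ (x : UnitAddCircle) (n : ℕ), 1 ≤ n → f^[n] x ≠ x) :
    ∃ g : ℕ → UnitAddCircle → ℝ, ∀ n, 1 ≤ n → Continuous (g n) ∧
      ∀ x, 0 < g n x ∧ g n x < 1 ∧ (g n x : UnitAddCircle) = f^[n] x - x := by
  have : ∀ n : ℕ, ∃ g : UnitAddCircle → ℝ, 1 ≤ n → Continuous g ∧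
      ∀ x, 0 < g x ∧ g x < 1 ∧ (g x : UnitAddCircle) = f^[n] x - x := fun n => by
    by_cases hn : 1 ≤ n
    · obtain ⟨g, hg⟩ := exists_continuous_lift_of_ne_zero (φ := fun x => f^[n] x - x)
        ((hf.iterate n).sub continuous_id) (fun x => sub_ne_zero.2 (hper x n hn))
      exact ⟨g, fun _ => hg⟩
    · exact ⟨0, fun h => absurd h hn⟩
  choose g hg using this
  exact ⟨g, hg⟩

theorem displacement_sub_eq {f : UnitAddCircle → UnitAddCircle} (hf : Continuous f)
    {g : ℕ → UnitAddCircle → ℝ}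
    (hg : ∀ n, 1 ≤ n → Continuous (g n) ∧
      ∀ x, 0 < g n x ∧ g n x < 1 ∧ (g n x : UnitAddCircle) = f^[n] x - x)
    {c w : UnitAddCircle} (hcw : f c = f w) {n : ℕ} (hn : 1 ≤ n) :
    g n c - g n w = g 1 c - g 1 w := by
  obtain ⟨m, rfl⟩ := Nat.exists_eq_add_of_le' hn
  rcases Nat.eq_zero_or_pos m with rfl | hm
  · rfl
  have h := eq_of_continuous_of_coe_eq_zero
    (u := fun x => g (m + 1) x - g 1 x - g m (f x))
    (((hg _ hn).1.sub (hg 1 le_rfl).1).sub ((hg m hm).1.comp hf)) (fun x => by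
      simp only [AddCircle.coe_sub, ((hg _ hn).2 x).2.2, ((hg 1 le_rfl).2 x).2.2,
        ((hg m hm).2 (f x)).2.2, Function.iterate_succ_apply, Function.iterate_zero, id]
      abel) c w
  simp only [hcw] at h
  linarith

/-- A point sharing its image with another point is not accumulated from one side by its own
forward orbit. -/
theorem exists_avoided_arc {f : UnitAddCircle → UnitAddCircle} (hf : Continuous f)
    (hper : ∀ (x : UnitAddCircle) (n : ℕ), 1 ≤ n → f^[n] x ≠ x)
    {c w : UnitAddCircle} (hcw : f c = f w) (hne : c ≠ w) :
    ∃ σ : ℝ, (σ = 1 ∨ σ = -1) ∧ ∃ δ > 0, ∀ n : ℕ, 1 ≤ n → ∀ t ∈ Ioo 0 δ,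
      f^[n] c - c ≠ ((σ * t : ℝ) : UnitAddCircle) := by
  obtain ⟨g, hg⟩ := exists_displacement hf hper
  have hd : g 1 c ≠ g 1 w := fun h => hne <| by
    have h1 := ((hg 1 le_rfl).2 c).2.2
    rw [h, ((hg 1 le_rfl).2 w).2.2] at h1
    simpa [hcw] using h1.symm
  rcases lt_or_gt_of_ne hd with hlt | hlt
  · refine ⟨-1, Or.inr rfl, g 1 w - g 1 c, sub_pos.2 hlt, fun n hn t ht h => ?_⟩
    have e := displacement_sub_eq hf hg hcw hn
    obtain ⟨hc0, hc1, hc⟩ := (hg n hn).2 c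
    obtain ⟨hw0, hw1, -⟩ := (hg n hn).2 w
    obtain ⟨ht0, ht1⟩ := ht
    have h2 : (g n c : UnitAddCircle) = ((1 - t : ℝ) : UnitAddCircle) := by
      rw [hc, h, AddCircle.coe_sub, AddCircle.coe_period]
      simp
    have := eq_of_coe_eq_coe_of_abs_sub_lt_one h2 (by rw [abs_lt]; constructor <;> linarith)
    linarith
  · refine ⟨1, Or.inl rfl, g 1 c - g 1 w, sub_pos.2 hlt, fun n hn t ht h => ?_⟩
    have e := displacement_sub_eq hf hg hcw hn
    obtain ⟨hc0, hc1, hc⟩ := (hg n hn).2 c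
    obtain ⟨hw0, hw1, -⟩ := (hg n hn).2 w
    obtain ⟨ht0, ht1⟩ := ht
    have h2 : (g n c : UnitAddCircle) = (t : UnitAddCircle) := by
      rw [hc, h, one_mul]
    have := eq_of_coe_eq_coe_of_abs_sub_lt_one h2 (by rw [abs_lt]; constructor <;> linarith)
    linarith

theorem UnitAddCircle.exists_coe_eq_abs_eq_norm (x : UnitAddCircle) :
    ∃ u : ℝ, (u : UnitAddCircle) = x ∧ |u| = ‖x‖ := by
  induction x using QuotientAddGroup.induction_on with
  | H r =>
    refine ⟨r - round r, ?_, UnitAddCircle.norm_eq.symm⟩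
    rw [AddCircle.coe_sub, sub_eq_self]
    exact (AddCircle.coe_eq_zero_iff (1 : ℝ)).2 ⟨round r, by simp⟩

/-- Almost every point is accumulated from either side by its forward orbit. -/
theorem volume_setOf_avoids_arc_eq_zero {f : UnitAddCircle → UnitAddCircle} (hf : Continuous f)
    (hpres : MeasurePreserving f)
    (hper : ∀ (x : UnitAddCircle) (n : ℕ), 1 ≤ n → f^[n] x ≠ x)
    {σ : ℝ} (hσ : σ = 1 ∨ σ = -1) {δ : ℝ} (hδ : 0 < δ) :
    volume {x : UnitAddCircle | ∀ n : ℕ, 1 ≤ n → ∀ t ∈ Ioo 0 δ,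
      f^[n] x - x ≠ ((σ * t : ℝ) : UnitAddCircle)} = 0 := by
  set A := {x : UnitAddCircle | ∀ n : ℕ, 1 ≤ n → ∀ t ∈ Ioo 0 δ,
      f^[n] x - x ≠ ((σ * t : ℝ) : UnitAddCircle)} with hA
  have hσ2 : σ * σ = 1 := by rcases hσ with rfl | rfl <;> norm_num
  have hAclosed : IsClosed A := by
    have hO : IsOpen ((fun s : ℝ => (s : UnitAddCircle)) '' {s | σ * s ∈ Ioo 0 δ}) :=
      QuotientAddGroup.isOpenMap_coe _
        (isOpen_Ioo.preimage (continuous_const.mul continuous_id))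
    have : A = ⋂ n : ℕ, ⋂ _ : 1 ≤ n, (fun x => f^[n] x - x) ⁻¹'
        ((fun s : ℝ => (s : UnitAddCircle)) '' {s | σ * s ∈ Ioo 0 δ})ᶜ := by
      ext x
      simp only [hA, mem_ofPred_eq, mem_iInter, mem_preimage, mem_compl_iff, mem_image, not_exists,
        not_and]
      refine forall₂_congr fun n _ =>
        ⟨fun h s hs e => h _ hs ?_, fun h t ht e => h (σ * t) ?_ e.symm⟩
      · rw [← mul_assoc, hσ2, one_mul, e]
      · rwa [← mul_assoc, hσ2, one_mul]
    rw [this]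
    exact isClosed_iInter fun n => isClosed_iInter fun _ =>
      hO.isClosed_compl.preimage ((hf.iterate n).sub continuous_id)
  by_contra hpos
  obtain ⟨x₀, -, hx₀⟩ := exists_mem_forall_mem_nhdsWithin_pos_measure hpos
  set s := Metric.ball x₀ (δ / 4) ∩ A with hs
  have hspos : 0 < volume s := hx₀ s
    (inter_mem (mem_nhdsWithin_of_mem_nhds (Metric.ball_mem_nhds x₀ (by positivity)))
      self_mem_nhdsWithin)
  have hsm : MeasurableSet s := Metric.isOpen_ball.measurableSet.inter hAclosed.measurableSet
  have hcons := hpres.conservative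
  obtain ⟨x, hxs, hx1, hx2⟩ : ∃ x ∈ s, (x ∈ s → ∃ᶠ n in atTop, f^[n] x ∈ s) ∧
      ∀ U ∈ 𝓝 x, ∃ᶠ n in atTop, f^[n] x ∈ U := by
    by_contra! hcon
    refine hspos.ne' (measure_mono_null (fun x hx => ?_)
      ((hcons.ae_mem_imp_frequently_image_mem hsm.nullMeasurableSet).and
        hcons.ae_frequently_mem_of_mem_nhds))
    rintro ⟨h1, h2⟩
    obtain ⟨U, hU, hU'⟩ := hcon x hx h1
    exact h2 U hU hU'
  obtain ⟨n, hn, hys⟩ := (frequently_atTop.1 (hx1 hxs)) 1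
  obtain ⟨u, hu, hun⟩ := UnitAddCircle.exists_coe_eq_abs_eq_norm (f^[n] x - x)
  have hu0 : u ≠ 0 := by
    rintro rfl
    exact hper x n hn (sub_eq_zero.1 (by simpa using hu.symm))
  have hud : |u| < δ / 2 := by
    rw [hun, ← dist_eq_norm]
    have h1 := Metric.mem_ball.1 hxs.1
    have h2 := Metric.mem_ball.1 hys.1
    have := dist_triangle_right (f^[n] x) x x₀
    linarith
  obtain ⟨k, hk, hkx⟩ := (frequently_atTop.1
    (hx2 _ (Metric.ball_mem_nhds x (abs_pos.2 hu0)))) (n + 1)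
  obtain ⟨t, ht, htn⟩ := UnitAddCircle.exists_coe_eq_abs_eq_norm (f^[k] x - x)
  have htu : |t| < |u| := by
    rw [htn, ← dist_eq_norm]
    exact Metric.mem_ball.1 hkx
  have hσu : ¬ 0 < σ * u := fun h => hxs.2 n hn (σ * u)
    ⟨h, lt_of_le_of_lt (le_abs_self _) (by
      rw [abs_mul]
      rcases hσ with rfl | rfl <;> simp <;> linarith)⟩
    (by rw [← mul_assoc, hσ2, one_mul, hu])
  refine hys.2 (k - n) (by omega) (σ * (t - u)) ?_ ?_
  · rw [abs_lt] at htu hud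
    rcases hσ with rfl | rfl
    · have : |u| = -u := abs_of_nonpos (by linarith)
      constructor <;> linarith
    · have : |u| = u := abs_of_nonneg (by linarith)
      constructor <;> linarith
  · rw [← mul_assoc, hσ2, one_mul, AddCircle.coe_sub, ht, hu, ← Function.iterate_add_apply,
      Nat.sub_add_cancel (by omega)]
    abel

/-- A non-injective measure-preserving circle map without periodic points fails to be injective
on a set of positive measure. -/
theorem volume_setOf_not_injective_ne_zero {f : UnitAddCircle → UnitAddCircle}
    (hf : Continuous f) (hpres : MeasurePreserving f)
    (hper : ∀ (x : UnitAddCircle) (n : ℕ), 1 ≤ n → f^[n] x ≠ x)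
    (hinj : ¬ Function.Injective f) :
    volume {x : UnitAddCircle | ∃ y, f x = f y ∧ x ≠ y} ≠ 0 := by
  obtain ⟨g, hgc, hg⟩ := exists_continuous_lift_of_ne_zero (φ := fun x => f x - x)
    (hf.sub continuous_id) (fun x => sub_ne_zero.2 (by simpa using hper x 1 le_rfl))
  set G : ℝ → ℝ := fun t => t + g t with hG
  have hGc : Continuous G := continuous_id.add (hgc.comp (AddCircle.continuous_mk' 1))
  have hGf : ∀ t : ℝ, (G t : UnitAddCircle) = f t := fun t => by
    simp [hG, (hg t).2.2]
  obtain ⟨a, b, hab, hab1, hGab⟩ : ∃ a b : ℝ, a < b ∧ b < a + 1 ∧ G a = G b := by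
    obtain ⟨c, w, hcw, hne, hlt⟩ : ∃ c w, f c = f w ∧ c ≠ w ∧ g w ≤ g c := by
      simp only [Function.Injective, not_forall] at hinj
      obtain ⟨c, w, h, hne⟩ := hinj
      rcases le_total (g w) (g c) with hle | hle
      · exact ⟨c, w, h, hne, hle⟩
      · exact ⟨w, c, h.symm, Ne.symm hne, hle⟩
    have hd : ((g c - g w : ℝ) : UnitAddCircle) = w - c := by
      rw [AddCircle.coe_sub, (hg c).2.2, (hg w).2.2, hcw]
      abel
    obtain ⟨a, rfl⟩ := QuotientAddGroup.mk_surjective c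
    have hb : ((a + (g a - g w) : ℝ) : UnitAddCircle) = w := by
      rw [AddCircle.coe_add, hd]
      exact add_sub_cancel _ _
    have hne' : g w ≠ g a := fun h => hne (by rw [← hb, h]; simp)
    have := lt_of_le_of_ne hlt hne'
    refine ⟨a, a + (g a - g w), ?_, ?_, ?_⟩
    · change g w < g a at this
      linarith
    · have h1 : g a < 1 := (hg a).2.1
      have h2 := (hg w).1
      linarith
    · simp only [hG, hb]
      ring
  have hcoe : IsOpenMap (fun s : ℝ => (s : UnitAddCircle)) := QuotientAddGroup.isOpenMap_coe
  have hne_coe : ∀ p q : ℝ, p < q → q - p < 1 → (p : UnitAddCircle) ≠ q := fun p q hpq h1 e => by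
    have := eq_of_coe_eq_coe_of_abs_sub_lt_one e (by rw [abs_lt]; constructor <;> linarith)
    linarith
  by_cases hconst : ∀ m ∈ Icc a b, G m = G a
  · refine fun h0 => ((hcoe _ (isOpen_Ioo (a := a) (b := b))).measure_pos volume
      ((nonempty_Ioo.2 hab).image _)).ne' (measure_mono_null ?_ h0)
    rintro _ ⟨m, hm, rfl⟩
    refine ⟨(a : UnitAddCircle), ?_, (hne_coe a m hm.1 (by linarith [hm.2])).symm⟩
    rw [← hGf, ← hGf, hconst m ⟨hm.1.le, hm.2.le⟩]
  · push Not at hconst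
    obtain ⟨m, hm, hGm⟩ := hconst
    have hVne : (uIoo (G a) (G m)).Nonempty := nonempty_uIoo.2 hGm.symm
    have hV := hcoe _ (isOpen_Ioo (a := min (G a) (G m)) (b := max (G a) (G m)))
    refine fun h0 => ?_
    have hpos := hV.measure_pos volume (hVne.image _)
    rw [← hpres.measure_preimage hV.measurableSet.nullMeasurableSet] at hpos
    refine hpos.ne' (measure_mono_null ?_ h0)
    rintro x ⟨v, hv, hvx⟩
    have hvm : v ≠ G m := by
      rintro rfl
      exact absurd hv (by simpa using le_of_lt)
    have hvI : v ∈ uIcc (G a) (G m) := Ioo_subset_Icc_self hv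
    obtain ⟨p, hp, hGp⟩ := intermediate_value_uIcc hGc.continuousOn hvI
    have hvI' : v ∈ uIcc (G m) (G b) := by rwa [← hGab, uIcc_comm]
    obtain ⟨q, hq, hGq⟩ := intermediate_value_uIcc hGc.continuousOn hvI'
    rw [uIcc_of_le hm.1] at hp
    rw [uIcc_of_le hm.2] at hq
    have hpm : p < m := lt_of_le_of_ne hp.2 (by rintro rfl; exact hvm hGp.symm)
    have hpq := hne_coe p q (hpm.trans_le hq.1) (by linarith [hp.1, hq.2])
    have hfx : f x = v := hvx.symm
    by_cases hxp : x = p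
    · exact ⟨q, by rw [hfx, ← hGf, hGq], hxp ▸ hpq⟩
    · exact ⟨p, by rw [hfx, ← hGf, hGp], hxp⟩

theorem measurePreserving_no_periodic_injective
    (f : UnitAddCircle → UnitAddCircle) (hf : Continuous f)
    (hpres : ∀ A : Set UnitAddCircle, MeasurableSet A → volume (f ⁻¹' A) = volume A)
    (hper : ∀ (x : UnitAddCircle) (n : ℕ), 1 ≤ n → f^[n] x ≠ x) :
    Function.Injective f := by
  have hmp : MeasurePreserving f := ⟨hf.measurable, by
    ext A hA
    rw [Measure.map_apply hf.measurable hA, hpres A hA]⟩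
  by_contra hinj
  refine volume_setOf_not_injective_ne_zero hf hmp hper hinj ?_
  have hnull : ∀ σ : ℝ, (σ = 1 ∨ σ = -1) → ∀ k : ℕ, volume {x : UnitAddCircle | ∀ n : ℕ, 1 ≤ n →
      ∀ t ∈ Ioo 0 (1 / ((k : ℝ) + 1)), f^[n] x - x ≠ ((σ * t : ℝ) : UnitAddCircle)} = 0 :=
    fun σ hσ k => volume_setOf_avoids_arc_eq_zero hf hmp hper hσ (by positivity)
  refine measure_mono_null ?_ (measure_union_null
    (measure_iUnion_null (hnull 1 (Or.inl rfl))) (measure_iUnion_null (hnull (-1) (Or.inr rfl))))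
  rintro x ⟨y, hxy, hne⟩
  obtain ⟨σ, hσ, δ, hδ, h⟩ := exists_avoided_arc hf hper hxy hne
  obtain ⟨k, hk⟩ := exists_nat_one_div_lt hδ
  have hmem : ∀ n : ℕ, 1 ≤ n → ∀ t ∈ Ioo 0 (1 / ((k : ℝ) + 1)),
      f^[n] x - x ≠ ((σ * t : ℝ) : UnitAddCircle) :=
    fun n hn t ht => h n hn t ⟨ht.1, ht.2.trans hk⟩
  rcases hσ with rfl | rfl
  · exact Or.inl (mem_iUnion.2 ⟨k, hmem⟩)
  · exact Or.inr (mem_iUnion.2 ⟨k, hmem⟩)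
end
end

section
/- For a continuous map f : [0,1] → [0,1] the following conditions are equivalent: (i) the set Per(f) of periodic points of f is dense in [0,1]; (ii) f preserves some non-atomic Borel probability measure μ on [0,1] with full support; (iii) there exists a homeomorphism h of [0,1] such that h ∘ f ∘ h⁻¹ preserves the Lebesgue measure λ. -/
open MeasureTheory Set Metric Filter Topology

noncomputable section

/-- Lebesgue measure on the unit interval `[0,1]`, viewed as a measure on the subtype. -/
def lebI : Measure unitInterval := (volume : Measure ℝ).comap Subtype.val

/-- A continuous self-map of `[0,1]` preserves Lebesgue measure. -/
def MeasPres (f : C(unitInterval, unitInterval)) : Prop :=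
  ∀ A : Set unitInterval, MeasurableSet A → lebI (f ⁻¹' A) = lebI A

/-- The space `C_λ(I)` of continuous Lebesgue-measure-preserving maps of `[0,1]`. -/
def CLam : Set C(unitInterval, unitInterval) := {f | MeasPres f}

/-- `Fix(f,k) = {x : f^k x = x}`. -/
def FixSet {X : Type*} (f : X → X) (k : ℕ) : Set X := {x | f^[k] x = x}

/-- `Per(f,k) = {x : f^k x = x and f^i x ≠ x for 1 ≤ i < k}`. -/
def PerSet {X : Type*} (f : X → X) (k : ℕ) : Set X :=
  {x | f^[k] x = x ∧ ∀ i : ℕ, 1 ≤ i → i < k → f^[i] x ≠ x}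

/-- `Per(f) = ⋃_{k ≥ 1} Fix(f,k)`, the set of all periodic points. -/
def PerAll {X : Type*} (f : X → X) : Set X := ⋃ k ∈ {k : ℕ | 1 ≤ k}, FixSet f k

/-- A Cantor set: nonempty, compact, perfect and totally disconnected. -/
def IsCantorSet {X : Type*} [TopologicalSpace X] (C : Set X) : Prop :=
  C.Nonempty ∧ IsCompact C ∧ Perfect C ∧ IsTotallyDisconnected C

open scoped BoundedContinuousFunction ENNReal

variable {X : Type*}

lemma exists_iterate_mem_Ico_of_lt_map [LinearOrder X] {g : X → X} {a e b z : X}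
    (hz : z ∈ Function.periodicPts g) (haz : a < z) (hlt : ∀ x, a < x → x < e → x < g x ∧ g x < b)
    (hze : z < e) :
    ∃ i, g^[i] z ∈ Ico e b := by
  obtain ⟨m, hm, hmz⟩ := hz
  have hex : ∃ i, e ≤ g^[i] z := by
    by_contra! h
    have hmem : ∀ i, a < g^[i] z := by
      intro i
      induction i with
      | zero => exact haz
      | succ i ih =>
        rw [Function.iterate_succ_apply']
        exact ih.trans (hlt _ ih (h i)).1
    have hmono : StrictMono fun i => g^[i] z := strictMono_nat_of_lt_succ fun i => by
      rw [Function.iterate_succ_apply']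
      exact (hlt _ (hmem i) (h i)).1
    exact (hmono hm).ne' hmz
  classical
  have hmem : ∀ i, i < Nat.find hex → a < g^[i] z := by
    intro i
    induction i with
    | zero => exact fun _ => haz
    | succ i ih =>
      intro hi
      rw [Function.iterate_succ_apply']
      have := ih (by omega)
      exact this.trans (hlt _ this (not_le.1 (Nat.find_min hex (by omega)))).1
  refine ⟨Nat.find hex, Nat.find_spec hex, ?_⟩
  obtain ⟨j, hj⟩ : ∃ j, Nat.find hex = j + 1 :=
    Nat.exists_eq_succ_of_ne_zero fun h => by
      have := Nat.find_spec hex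
      rw [h] at this
      exact (this.trans_lt hze).false
  rw [hj, Function.iterate_succ_apply']
  exact (hlt _ (hmem j (by omega)) (not_le.1 (Nat.find_min hex (by omega)))).2

/-- Two disjoint closed sets, each of which `g` maps onto the union of both. -/
def IsHorseshoe [TopologicalSpace X] (g : X → X) (A B : Set X) : Prop :=
  IsClosed A ∧ IsClosed B ∧ Disjoint A B ∧ (A ∪ B).Nonempty ∧ g '' A = A ∪ B ∧ g '' B = A ∪ B

section
variable [ConditionallyCompleteLinearOrder X] [TopologicalSpace X] [OrderTopology X]
  [DenselyOrdered X]

lemma isHorseshoe_of_fold {g : X → X} (hg : Continuous g) {e w b : X} (hew : e < w) (hwb : w < b)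
    (he : g e = b) (hw : g w < e) (hb : g b = b) :
    ∃ A B, IsHorseshoe g A B ∧ A ∪ B ⊆ Icc e b := by
  set K : Set X := {x | ∀ n, g^[n] x ∈ Icc e b} with hK
  have hKc : IsClosed K := by
    simp only [hK, Set.ofPred_forall]
    exact isClosed_iInter fun n => isClosed_Icc.preimage (hg.iterate n)
  have hKsub : K ⊆ Icc e b := fun x hx => hx 0
  have hKg : ∀ x ∈ K, g x ∈ K := fun x hx n => hx (n + 1)
  have hKg' : ∀ x ∈ Icc e b, g x ∈ K → x ∈ K := fun x hx hgx n => by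
    cases n with
    | zero => exact hx
    | succ n => exact hgx n
  have hwK : w ∉ K := fun h => hw.not_ge (hKsub (hKg w h)).1
  have hunion : K ∩ Iic w ∪ K ∩ Ici w = K := by
    rw [← inter_union_distrib_left, Iic_union_Ici, inter_univ]
  refine ⟨K ∩ Iic w, K ∩ Ici w, ⟨hKc.inter isClosed_Iic, hKc.inter isClosed_Ici, ?_, ?_, ?_, ?_⟩,
    hunion.trans_subset hKsub⟩
  · rw [Set.disjoint_left]
    rintro x ⟨hx, hxw⟩ ⟨-, hwx⟩
    exact hwK (le_antisymm hxw hwx ▸ hx)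
  · rw [hunion]
    exact ⟨b, fun n => by rw [Function.iterate_fixed hb]; exact ⟨(hew.trans hwb).le, le_rfl⟩⟩
  · rw [hunion]
    refine Subset.antisymm (image_subset_iff.2 fun x hx => hKg x hx.1) fun y hy => ?_
    obtain ⟨x, hx, rfl⟩ := intermediate_value_Icc' hew.le hg.continuousOn
      ⟨hw.le.trans (hKsub hy).1, he.symm ▸ (hKsub hy).2⟩
    exact ⟨x, ⟨hKg' x ⟨hx.1, hx.2.trans hwb.le⟩ hy, hx.2⟩, rfl⟩
  · rw [hunion]
    refine Subset.antisymm (image_subset_iff.2 fun x hx => hKg x hx.1) fun y hy => ?_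
    obtain ⟨x, hx, rfl⟩ := intermediate_value_Icc hwb.le hg.continuousOn
      ⟨hw.le.trans (hKsub hy).1, hb.symm ▸ (hKsub hy).2⟩
    exact ⟨x, ⟨hKg' x ⟨hew.le.trans hx.1, hx.2⟩ hy, hx.1⟩, rfl⟩

lemma exists_isHorseshoe_of_lt {g : X → X} (hg : Continuous g)
    (hd : Dense (Function.periodicPts g)) {a b c : X} (ha : g a = a) (hb : g b = b)
    (hc : c ∈ Ioo a b) (hgc : c < g c) :
    ∃ n, 0 < n ∧ ∃ A B, IsHorseshoe g^[n] A B ∧ A ∪ B ⊆ Icc a b := by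
  have hfix : IsClosed {x | g x = x} := isClosed_eq hg continuous_id
  -- the component of `{x | x < g x}` containing `c`
  obtain ⟨a', ha', hamax⟩ : ∃ a', (a' ∈ Icc a c ∧ g a' = a') ∧
      ∀ x ∈ Icc a c, g x = x → x ≤ a' := by
    obtain ⟨a', h, h'⟩ := (isCompact_Icc.inter_right hfix).exists_isGreatest
      ⟨a, ⟨le_rfl, hc.1.le⟩, ha⟩
    exact ⟨a', h, fun x hx hxg => h' ⟨hx, hxg⟩⟩
  obtain ⟨b', hb', hbmin⟩ : ∃ b', (b' ∈ Icc c b ∧ g b' = b') ∧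
      ∀ x ∈ Icc c b, g x = x → b' ≤ x := by
    obtain ⟨b', h, h'⟩ := (isCompact_Icc.inter_right hfix).exists_isLeast
      ⟨b, ⟨hc.2.le, le_rfl⟩, hb⟩
    exact ⟨b', h, fun x hx hxg => h' ⟨hx, hxg⟩⟩
  have hac : a' < c := ha'.1.2.lt_of_ne fun h => hgc.ne' (h ▸ ha'.2)
  have hcb : c < b' := hb'.1.1.lt_of_ne fun h => hgc.ne' (h ▸ hb'.2)
  have hnofix : ∀ x ∈ Ioo a' b', g x ≠ x := by
    intro x hx h
    rcases le_total x c with hxc | hxc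
    · exact hx.1.not_ge (hamax x ⟨ha'.1.1.trans hx.1.le, hxc⟩ h)
    · exact hx.2.not_ge (hbmin x ⟨hxc, hx.2.le.trans hb'.1.2⟩ h)
  have hup : ∀ x ∈ Ioo a' b', x < g x := by
    intro x hx
    by_contra! h
    obtain ⟨y, hy, hyg⟩ := isPreconnected_Ioo.intermediate_value₂ hx ⟨hac, hcb⟩
      hg.continuousOn continuousOn_id h hgc.le
    exact hnofix y hy hyg
  have hab : a' < b' := hac.trans hcb
  -- the first point of `[a', b']` sent to `b'`
  obtain ⟨e, ⟨heI, heb⟩, hemin⟩ := (isCompact_Icc.inter_right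
    (isClosed_eq hg (continuous_const (y := b')))).exists_isLeast
      (⟨b', ⟨hab.le, le_rfl⟩, hb'.2⟩ : (Icc a' b' ∩ {x | g x = b'}).Nonempty)
  have hae : a' < e := heI.1.lt_of_ne fun h => hab.ne (by rw [← ha'.2, h, ← heb])
  have hbelow : ∀ x, a' < x → x < e → x < g x ∧ g x < b' := by
    refine fun x hax hxe => ⟨hup x ⟨hax, hxe.trans_le heI.2⟩, ?_⟩
    by_contra! h
    obtain ⟨y, hy, hyg⟩ := intermediate_value_Icc hax.le hg.continuousOn
      (⟨by rw [ha'.2]; exact hab.le, h⟩ : b' ∈ Icc (g a') (g x))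
    exact (hy.2.trans_lt hxe).not_ge
      (hemin ⟨⟨hy.1, hy.2.trans (hxe.le.trans heI.2)⟩, hyg⟩)
  obtain ⟨z, hz, haz, hze⟩ := hd.exists_between hae
  obtain ⟨i, hei, hib⟩ := exists_iterate_mem_Ico_of_lt_map hz haz hbelow hze
  obtain ⟨m, hm, hmz⟩ := hz
  have hfixb : ∀ n, 0 < n → g^[n] e = b' := by
    intro n hn
    obtain ⟨k, rfl⟩ := Nat.exists_eq_succ_of_ne_zero hn.ne'
    rw [Function.iterate_succ_apply, show g e = b' from heb, Function.iterate_fixed hb'.2]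
  have hreturn : g^[m * (i + 1) - i] (g^[i] z) = z := by
    rw [← Function.iterate_add_apply, Nat.sub_add_cancel (by nlinarith)]
    exact hmz.mul_const _
  have hpos : 0 < m * (i + 1) - i := Nat.sub_pos_of_lt (by nlinarith)
  have hew : e < g^[i] z := hei.lt_of_ne fun h => by
    rw [← h, hfixb _ hpos] at hreturn
    exact (hze.trans_le heI.2).ne' hreturn
  obtain ⟨A, B, hAB, hsub⟩ := isHorseshoe_of_fold (hg.iterate (m * (i + 1) - i)) hew hib
    (hfixb _ hpos) (by rwa [hreturn]) (Function.iterate_fixed hb'.2 _)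
  exact ⟨_, hpos, A, B, hAB, hsub.trans (Icc_subset_Icc (ha'.1.1.trans hae.le) hb'.1.2)⟩

lemma exists_isHorseshoe_of_ne {g : X → X} (hg : Continuous g)
    (hd : Dense (Function.periodicPts g)) {a b c : X} (ha : g a = a) (hb : g b = b)
    (hc : c ∈ Ioo a b) (hgc : g c ≠ c) :
    ∃ n, 0 < n ∧ ∃ A B, IsHorseshoe g^[n] A B ∧ A ∪ B ⊆ Icc a b := by
  rcases hgc.lt_or_gt with h | h
  · obtain ⟨n, hn, A, B, hAB, hsub⟩ := exists_isHorseshoe_of_lt (X := Xᵒᵈ) (g := g) hg hd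
      (a := b) (b := a) (c := c) hb ha ⟨hc.2, hc.1⟩ h
    exact ⟨n, hn, A, B, hAB, fun x hx => ⟨(hsub hx).2, (hsub hx).1⟩⟩
  · exact exists_isHorseshoe_of_lt hg hd ha hb hc h

end

lemma lt_iterate_mul [LinearOrder X] [TopologicalSpace X] [OrderClosedTopology X] {f : X → X}
    (hf : Continuous f) {J : Set X} (hJ : IsPreconnected J)
    (hper : ∀ x ∈ J, x ∉ Function.periodicPts f) {x : X} {n : ℕ} (hx : x ∈ J)
    (hn : f^[n] x ∈ J) (hlt : x < f^[n] x) (j : ℕ) {z : X} (hz : z ∈ J) :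
    z < f^[n * (j + 1)] z := by
  have hnpos : 0 < n := Nat.pos_of_ne_zero fun h => by simp [h] at hlt
  have key : ∀ m, 0 < m → ∀ x ∈ J, x < f^[m] x → ∀ z ∈ J, z < f^[m] z := by
    intro m hm x hx hlt z hz
    by_contra! h
    obtain ⟨y, hy, hyg⟩ := hJ.intermediate_value₂ hz hx
      (hf.iterate m).continuousOn continuousOn_id h hlt.le
    exact hper y hy ⟨m, hm, hyg⟩
  induction j generalizing z with
  | zero => simpa using key n hnpos x hx hlt z hz
  | succ j ih =>
    refine key _ (by positivity) x hx ?_ z hz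
    rw [mul_add_one n (j + 1), Function.iterate_add_apply]
    exact hlt.trans (ih hn)

/-- The average of `μ 0, …, μ n`. -/
def avgMeasure [MeasurableSpace X] (μ : ℕ → Measure X) (n : ℕ) : Measure X :=
  ((n + 1 : ℕ) : ℝ≥0∞)⁻¹ • ∑ i ∈ Finset.range (n + 1), μ i

lemma avgMeasure_apply [MeasurableSpace X] (μ : ℕ → Measure X) (n : ℕ) (s : Set X) :
    avgMeasure μ n s = ((n + 1 : ℕ) : ℝ≥0∞)⁻¹ * ∑ i ∈ Finset.range (n + 1), μ i s := by
  simp [avgMeasure]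

instance [MeasurableSpace X] (μ : ℕ → Measure X) [∀ i, IsProbabilityMeasure (μ i)] (n : ℕ) :
    IsProbabilityMeasure (avgMeasure μ n) := by
  constructor
  rw [avgMeasure_apply]
  simp only [measure_univ, Finset.sum_const, Finset.card_range, nsmul_eq_mul, mul_one]
  exact ENNReal.inv_mul_cancel (by simp) (by simp)

lemma integral_avgMeasure [MeasurableSpace X] (μ : ℕ → Measure X) (n : ℕ) {φ : X → ℝ}
    (hφ : ∀ i, Integrable φ (μ i)) :
    ∫ x, φ x ∂avgMeasure μ n = ((n : ℝ) + 1)⁻¹ * ∑ i ∈ Finset.range (n + 1), ∫ x, φ x ∂μ i := by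
  rw [avgMeasure, integral_smul_measure, integral_finsetSum_measure fun i _ => hφ i,
    ENNReal.toReal_inv, ENNReal.toReal_natCast, smul_eq_mul, Nat.cast_succ]

lemma tendsto_cesaro_shift {a b : ℕ → ℝ} {C : ℝ} (ha : ∀ i, |a i| ≤ C)
    (hab : ∀ i, b (i + 1) = 2⁻¹ * a i) :
    Tendsto (fun n : ℕ => ((n : ℝ) + 1)⁻¹ * ∑ i ∈ Finset.range (n + 1), b i -
      2⁻¹ * (((n : ℝ) + 1)⁻¹ * ∑ i ∈ Finset.range (n + 1), a i)) atTop (𝓝 0) := by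
  have hdiff : ∀ n : ℕ, ((n : ℝ) + 1)⁻¹ * ∑ i ∈ Finset.range (n + 1), b i -
      2⁻¹ * (((n : ℝ) + 1)⁻¹ * ∑ i ∈ Finset.range (n + 1), a i) =
      (1 / ((n : ℝ) + 1)) * (b 0 - 2⁻¹ * a n) := by
    intro n
    rw [Finset.sum_range_succ' b, Finset.sum_range_succ a]
    simp only [hab, ← Finset.mul_sum]
    ring
  simp only [hdiff]
  refine tendsto_one_div_add_atTop_nhds_zero_nat.zero_mul_isBoundedUnder_le ?_
  refine isBoundedUnder_of ⟨|b 0| + 2⁻¹ * C, fun n => ?_⟩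
  have h := ha n
  calc ‖b 0 - 2⁻¹ * a n‖ ≤ |b 0| + |2⁻¹ * a n| := abs_sub _ _
    _ ≤ |b 0| + 2⁻¹ * C := by rw [abs_mul, abs_of_pos (by norm_num : (0 : ℝ) < 2⁻¹)]; gcongr

/-- The law of the endpoint of a random walk of length `n` started at `p`, each step of which
applies one of the two maps `s true`, `s false` with probability one half. -/
def walkMeasure [MeasurableSpace X] (s : Bool → X → X) : ℕ → X → Measure X
  | 0, p => Measure.dirac p
  | n + 1, p => ∑ b, (2⁻¹ : ℝ≥0∞) • walkMeasure s n (s b p)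

instance [MeasurableSpace X] (s : Bool → X → X) (n : ℕ) (p : X) :
    IsProbabilityMeasure (walkMeasure s n p) := by
  induction n generalizing p with
  | zero => exact Measure.dirac.isProbabilityMeasure
  | succ n ih =>
    constructor
    simp [walkMeasure, ENNReal.inv_two_add_inv_two]

lemma walkMeasure_succ_apply [MeasurableSpace X] {s : Bool → X → X} {g : X → X}
    (hg : Measurable g) {c : X → Bool} (hc : Measurable c) (hcs : ∀ b y, c (s b y) = b)
    (hgs : ∀ b y, g (s b y) = y) (b : Bool) {E : Set X} (hE : MeasurableSet E) (n : ℕ) (p : X) :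
    walkMeasure s (n + 1) p (g ⁻¹' E ∩ c ⁻¹' {b}) = 2⁻¹ * walkMeasure s n p E := by
  induction n generalizing p with
  | zero =>
    have hm : MeasurableSet (g ⁻¹' E ∩ c ⁻¹' {b}) := (hg hE).inter (hc trivial)
    cases b <;> by_cases hp : p ∈ E <;> simp [walkMeasure, hm, hE, hcs, hgs, hp]
  | succ n ih =>
    rw [walkMeasure]
    simp only [Measure.coe_finsetSum, Finset.sum_apply, Measure.smul_apply, ih, smul_eq_mul]
    rw [walkMeasure]
    simp [mul_add]

theorem exists_nonatomic_invariant_of_two_branches [MetricSpace X] [CompactSpace X] [Nonempty X]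
    [MeasurableSpace X] [BorelSpace X] {g : X → X} (hg : Continuous g) {c : X → Bool}
    (hc : Continuous c) (hsurj : ∀ b y, ∃ x, c x = b ∧ g x = y) :
    ∃ ν : Measure X, IsProbabilityMeasure ν ∧ (∀ x, ν {x} = 0) ∧ ν.map g = ν := by
  choose s hcs hgs using hsurj
  obtain ⟨p⟩ := ‹Nonempty X›
  let μ : ℕ → Measure X := fun i => walkMeasure s i p
  let ν' : ℕ → ProbabilityMeasure X := fun n => ⟨avgMeasure μ n, inferInstance⟩
  obtain ⟨ν, -, hν⟩ := isCompact_univ.ultrafilter_le_nhds ((hyperfilter ℕ).map ν') (by simp)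
  replace hν : Tendsto ν' (hyperfilter ℕ) (𝓝 ν) := hν
  rw [ProbabilityMeasure.tendsto_iff_forall_integral_tendsto] at hν
  have integrable_bdd : ∀ (φ : X →ᵇ ℝ) (m : Measure X) [IsFiniteMeasure m], Integrable φ m :=
    fun φ m _ => φ.integrable m
  have hhalf : ∀ b, (((ν : Measure X).restrict (c ⁻¹' {b})).map g) =
      (2⁻¹ : NNReal) • (ν : Measure X) := by
    intro b
    have hcl : IsClopen (c ⁻¹' {b}) := (isClopen_discrete {b}).preimage hc
    have hms := hcl.isOpen.measurableSet
    have hμ : ∀ i, ((μ (i + 1)).restrict (c ⁻¹' {b})).map g = (2⁻¹ : NNReal) • μ i := by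
      intro i
      ext E hE
      rw [Measure.map_apply hg.measurable hE, Measure.restrict_apply (hg.measurable hE),
        walkMeasure_succ_apply hg.measurable hc.measurable hcs hgs b hE]
      simp [μ, ENNReal.smul_def]
    refine ext_of_forall_integral_eq_of_IsFiniteMeasure fun φ => ?_
    let ψ : X →ᵇ ℝ := BoundedContinuousFunction.mkOfCompact
      ⟨(c ⁻¹' {b}).indicator (φ ∘ g), (φ.continuous.comp hg).indicator
        fun a ha => by simp [hcl.frontier_eq] at ha⟩
    have hψ : ∀ m : Measure X, ∫ x, ψ x ∂m = ∫ x, φ x ∂((m.restrict (c ⁻¹' {b})).map g) := by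
      intro m
      rw [integral_map hg.aemeasurable φ.continuous.aestronglyMeasurable,
        ← integral_indicator hms]
      rfl
    have hlim := tendsto_cesaro_shift (a := fun i => ∫ x, φ x ∂μ i) (b := fun i => ∫ x, ψ x ∂μ i)
      (C := ‖φ‖) (fun i => by simpa using φ.norm_integral_le_norm (μ i))
      (fun i => by rw [hψ, hμ, integral_smul_nnreal_measure]; simp [NNReal.smul_def])
    have hlim' := (hν ψ).sub ((hν φ).const_mul 2⁻¹)
    have heq := tendsto_nhds_unique hlim' ((hlim.mono_left Nat.hyperfilter_le_atTop).congr
      fun n => by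
        simp only [ν', ProbabilityMeasure.coe_mk]
        rw [integral_avgMeasure μ n fun i => integrable_bdd φ _,
          integral_avgMeasure μ n fun i => integrable_bdd ψ _])
    rw [← hψ, integral_smul_nnreal_measure]
    simp only [NNReal.smul_def]
    simpa using sub_eq_zero.1 heq
  have hhalf' : ∀ b E, MeasurableSet E → (ν : Measure X) (g ⁻¹' E ∩ c ⁻¹' {b}) =
      2⁻¹ * (ν : Measure X) E := by
    intro b E hE
    have := congrArg (fun m => m E) (hhalf b)
    simpa [Measure.map_apply hg.measurable hE, Measure.restrict_apply (hg.measurable hE),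
      ENNReal.smul_def] using this
  refine ⟨ν, inferInstance, fun x => ?_, ?_⟩
  · have hstep : ∀ x, (ν : Measure X) {x} ≤ 2⁻¹ * (ν : Measure X) {g x} := fun x => by
      rw [← hhalf' (c x) _ (measurableSet_singleton _)]
      exact measure_mono (by simp)
    have hpow : ∀ n x, (ν : Measure X) {x} ≤ 2⁻¹ ^ n := by
      intro n
      induction n with
      | zero => simpa using fun x => prob_le_one
      | succ n ih =>
        intro x
        rw [pow_succ']
        exact (hstep x).trans (by gcongr; exact ih _)
    exact le_antisymm (ge_of_tendsto' (ENNReal.tendsto_pow_atTop_nhds_zero_of_lt_one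
      (by simp)) fun n => hpow n x) zero_le
  · ext E hE
    rw [Measure.map_apply hg.measurable hE, ← measure_inter_add_sdiff _
      (hc.measurable (measurableSet_singleton true)), hhalf' _ _ hE]
    have : g ⁻¹' E \ c ⁻¹' {true} = g ⁻¹' E ∩ c ⁻¹' {false} := by ext; simp
    rw [this, hhalf' _ _ hE, ← add_mul, ENNReal.inv_two_add_inv_two, one_mul]

lemma IsHorseshoe.exists_invariant [MetricSpace X] [CompactSpace X] [MeasurableSpace X]
    [BorelSpace X] {g : X → X} (hg : Continuous g) {A B : Set X} (h : IsHorseshoe g A B) :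
    ∃ ν : Measure X, IsProbabilityMeasure ν ∧ (∀ x, ν {x} = 0) ∧ ν.map g = ν ∧ ν (A ∪ B) = 1 := by
  obtain ⟨hA, hB, hAB, hne, hgA, hgB⟩ := h
  set K := A ∪ B with hK
  have hKc : IsClosed K := hA.union hB
  have : CompactSpace K := isCompact_iff_compactSpace.1 hKc.isCompact
  have : Nonempty K := hne.to_subtype
  have hmaps : MapsTo g K K := by
    rintro x (hx | hx)
    · exact hgA ▸ mem_image_of_mem g hx
    · exact hgB ▸ mem_image_of_mem g hx
  classical
  have hcl : IsClopen ((↑) ⁻¹' A : Set K) := by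
    refine ⟨hA.preimage continuous_subtype_val, ?_⟩
    have : ((↑) ⁻¹' A : Set K) = ((↑) ⁻¹' B)ᶜ := by
      ext ⟨x, hx⟩
      exact ⟨fun h => hAB.notMem_of_mem_left h, fun h => hx.resolve_right h⟩
    rw [this]
    exact (hB.preimage continuous_subtype_val).isOpen_compl
  have hgK : Continuous (hmaps.restrict g K K) := hg.restrict hmaps
  have hcont : Continuous fun x : K => decide ((x : X) ∈ A) :=
    (continuous_bool_rng true).2 (by simpa [preimage, mem_singleton_iff] using hcl)
  have hsurj : ∀ b (y : K), ∃ x : K, decide ((x : X) ∈ A) = b ∧ hmaps.restrict g K K x = y := by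
    rintro b ⟨y, hy⟩
    cases b
    · obtain ⟨x, hx, hxy⟩ := hgB.symm.subset hy
      exact ⟨⟨x, Or.inr hx⟩, by simpa using hAB.notMem_of_mem_right hx, Subtype.ext hxy⟩
    · obtain ⟨x, hx, hxy⟩ := hgA.symm.subset hy
      exact ⟨⟨x, Or.inl hx⟩, by simpa using hx, Subtype.ext hxy⟩
  obtain ⟨ν, hν, hatom, hinv⟩ := exists_nonatomic_invariant_of_two_branches hgK hcont hsurj
  refine ⟨ν.map (↑), Measure.isProbabilityMeasure_map (by fun_prop), fun x => ?_, ?_, ?_⟩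
  · rw [Measure.map_apply measurable_subtype_coe (measurableSet_singleton x)]
    have : NullSingletonClass ν := ⟨hatom⟩
    have hx : ((↑) ⁻¹' {x} : Set K).Subsingleton :=
      subsingleton_singleton.preimage Subtype.val_injective
    exact hx.measure_zero ν
  · conv_rhs => rw [← hinv]
    rw [Measure.map_map hg.measurable measurable_subtype_coe,
      Measure.map_map measurable_subtype_coe hgK.measurable]
    rfl
  · rw [Measure.map_apply measurable_subtype_coe hKc.measurableSet]
    simp

lemma map_iterate_singleton_eq_zero [MeasurableSpace X] [MeasurableSingletonClass X] {f : X → X}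
    (hf : Measurable f) {ν : Measure X} (hatom : ∀ x, ν {x} = 0) {N : ℕ} (hN : 0 < N)
    (hinv : ν.map f^[N] = ν) (i : ℕ) (x : X) : ν.map f^[i] {x} = 0 := by
  rw [Measure.map_apply (hf.iterate i) (measurableSet_singleton x)]
  have hmp : MeasurePreserving (f^[N])^[i] ν ν :=
    MeasurePreserving.iterate ⟨hf.iterate N, hinv⟩ i
  have hle : i ≤ N * i := Nat.le_mul_of_pos_left i hN
  refine measure_mono_null (t := (f^[N])^[i] ⁻¹' {f^[N * i - i] x}) ?_ ?_
  · intro y hy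
    rw [mem_preimage, mem_singleton_iff] at hy ⊢
    rw [← hy, ← Function.iterate_mul, ← Function.iterate_add_apply, Nat.sub_add_cancel hle]
  · rw [hmp.measure_preimage (measurableSet_singleton _).nullMeasurableSet, hatom]

lemma exists_invariant_of_iterate [MeasurableSpace X] [MeasurableSingletonClass X] {f : X → X}
    (hf : Measurable f) {ν : Measure X} [IsProbabilityMeasure ν] (hatom : ∀ x, ν {x} = 0) {N : ℕ}
    (hN : 0 < N) (hinv : ν.map f^[N] = ν) {U : Set X} (hU : 0 < ν U) :
    ∃ μ : Measure X, IsProbabilityMeasure μ ∧ (∀ x, μ {x} = 0) ∧ μ.map f = μ ∧ 0 < μ U := by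
  obtain ⟨n, rfl⟩ := Nat.exists_eq_succ_of_ne_zero hN.ne'
  have : ∀ i, IsProbabilityMeasure (ν.map f^[i]) := fun i =>
    Measure.isProbabilityMeasure_map (hf.iterate i).aemeasurable
  refine ⟨avgMeasure (fun i => ν.map f^[i]) n, inferInstance, fun x => ?_, ?_, ?_⟩
  · rw [avgMeasure_apply]
    simp [map_iterate_singleton_eq_zero hf hatom hN hinv]
  · ext E hE
    rw [Measure.map_apply hf hE, avgMeasure_apply, avgMeasure_apply]
    congr 1
    have hshift : ∀ i, ν.map f^[i] (f ⁻¹' E) = ν.map f^[i + 1] E := fun i => by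
      rw [Function.iterate_succ', ← Measure.map_map hf (hf.iterate i), Measure.map_apply hf hE]
    simp only [hshift]
    rw [Finset.sum_range_succ, Finset.sum_range_succ' _ n, hinv]
    simp
  · rw [avgMeasure_apply]
    refine ENNReal.mul_pos (by simp) (ne_of_gt ?_)
    refine (?_ : 0 < ν.map f^[0] U).trans_le
      (Finset.single_le_sum (f := fun i => ν.map f^[i] U) (fun _ _ => zero_le) (by simp))
    simpa using hU

/-- Countably many invariant measures, one charging each basic open set, combine into one of full
support. -/
lemma exists_invariant_fullSupport [TopologicalSpace X] [T1Space X] [SecondCountableTopology X]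
    [Nonempty X] [MeasurableSpace X] [BorelSpace X] {f : X → X} (hf : Measurable f)
    (h : ∀ U : Set X, IsOpen U → U.Nonempty →
      ∃ μ : Measure X, IsProbabilityMeasure μ ∧ (∀ x, μ {x} = 0) ∧ μ.map f = μ ∧ 0 < μ U) :
    ∃ μ : Measure X, IsProbabilityMeasure μ ∧ (∀ x, μ {x} = 0) ∧
      (∀ U : Set X, IsOpen U → U.Nonempty → 0 < μ U) ∧ μ.map f = μ := by
  obtain ⟨b, hbc, hbe, hb⟩ := TopologicalSpace.exists_countable_basis X
  have hbne : b.Nonempty := by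
    obtain ⟨x⟩ := ‹Nonempty X›
    obtain ⟨v, hv, -⟩ := hb.exists_subset_of_mem_open (mem_univ x) isOpen_univ
    exact ⟨v, hv⟩
  obtain ⟨u, rfl⟩ := hbc.exists_eq_range hbne
  choose μ hprob hatom hinv hpos using fun n => h (u n) (hb.isOpen (mem_range_self n))
    (nonempty_iff_ne_empty.2 fun h => hbe ⟨n, h⟩)
  refine ⟨Measure.sum fun n => (2⁻¹ : ℝ≥0∞) ^ (n + 1) • μ n, ⟨?_⟩, fun x => ?_, ?_, ?_⟩
  · rw [Measure.sum_apply _ MeasurableSet.univ]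
    simpa [ENNReal.one_sub_inv_two, ENNReal.inv_mul_cancel] using
      ENNReal.tsum_geometric_add_one 2⁻¹
  · rw [Measure.sum_apply _ (measurableSet_singleton x)]
    simp [hatom]
  · intro U hU hUne
    obtain ⟨x, hx⟩ := hUne
    obtain ⟨_, ⟨n, rfl⟩, -, hnU⟩ := hb.exists_subset_of_mem_open hx hU
    refine lt_of_lt_of_le ?_ (Measure.le_sum_apply _ U)
    refine lt_of_lt_of_le ?_ (ENNReal.le_tsum n)
    exact ENNReal.mul_pos (by simp) ((hpos n).trans_le (measure_mono hnU)).ne'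
  · rw [Measure.map_sum hf.aemeasurable]
    simp [Measure.map_smul, hinv]

lemma exists_invariant_pos {f : unitInterval → unitInterval} (hf : Continuous f)
    (hd : Dense (Function.periodicPts f)) {U : Set unitInterval} (hU : IsOpen U)
    (hne : U.Nonempty) :
    ∃ μ : Measure unitInterval, IsProbabilityMeasure μ ∧ (∀ x, μ {x} = 0) ∧ μ.map f = μ ∧
      0 < μ U := by
  obtain ⟨u, v, huv, huvU⟩ := hU.exists_Ioo_subset hne
  obtain ⟨a, ⟨m, hm, hma⟩, hua, hav⟩ := hd.exists_between huv
  obtain ⟨b, ⟨n, hn, hnb⟩, hab, hbv⟩ := hd.exists_between hav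
  have hIcc : Icc a b ⊆ U := (Icc_subset_Ioo hua hbv).trans huvU
  have hN : 0 < m * n := Nat.mul_pos hm hn
  have hg : Continuous f^[m * n] := hf.iterate _
  by_cases hid : ∀ c ∈ Icc a b, f^[m * n] c = c
  · have hpos : volume (Icc a b) ≠ 0 := by
      simpa [unitInterval.volume_Icc] using hab
    have := ProbabilityTheory.cond_isProbabilityMeasure hpos
    refine exists_invariant_of_iterate hf.measurable (ν := ProbabilityTheory.cond volume (Icc a b))
      (fun x => ?_) hN ?_ ?_
    · exact ProbabilityTheory.cond_absolutelyContinuous (measure_singleton x)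
    · have hae : f^[m * n] =ᵐ[ProbabilityTheory.cond volume (Icc a b)] id :=
        (ProbabilityTheory.ae_cond_mem measurableSet_Icc).mono fun c hc => hid c hc
      rw [Measure.map_congr hae, Measure.map_id]
    · refine lt_of_lt_of_le ?_ (measure_mono hIcc)
      rw [ProbabilityTheory.cond_apply_self hpos (measure_ne_top _ _)]
      exact one_pos
  · push Not at hid
    obtain ⟨c, hc, hgc⟩ := hid
    have hga : f^[m * n] a = a := hma.mul_const n
    have hgb : f^[m * n] b = b := hnb.const_mul m
    have hc' : c ∈ Ioo a b := ⟨hc.1.lt_of_ne fun h => hgc (h ▸ hga),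
      hc.2.lt_of_ne fun h => hgc (h ▸ hgb)⟩
    have hd' : Dense (Function.periodicPts f^[m * n]) := hd.mono fun x hx => by
      obtain ⟨k, hk, hkx⟩ := hx
      refine ⟨k, hk, ?_⟩
      rw [Function.IsPeriodicPt, ← Function.iterate_mul]
      exact hkx.const_mul _
    obtain ⟨k, hk, A, B, hAB, hsub⟩ := exists_isHorseshoe_of_ne hg hd' hga hgb hc' hgc
    rw [← Function.iterate_mul] at hAB
    obtain ⟨ν, hν, hatom, hinv, hone⟩ := hAB.exists_invariant (hf.iterate _)
    refine exists_invariant_of_iterate hf.measurable hatom (Nat.mul_pos hN hk) hinv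
      (lt_of_lt_of_le ?_ (measure_mono (hsub.trans hIcc)))
    rw [hone]
    exact one_pos

lemma dense_periodicPts_of_invariant {f : unitInterval → unitInterval} (hf : Continuous f)
    {μ : Measure unitInterval} [IsProbabilityMeasure μ]
    (hpos : ∀ U : Set unitInterval, IsOpen U → U.Nonempty → 0 < μ U) (hinv : μ.map f = μ) :
    Dense (Function.periodicPts f) := by
  by_contra hd
  rw [dense_iff_inter_open] at hd
  push Not at hd
  obtain ⟨U, hU, hUne, hUper⟩ := hd
  obtain ⟨u, v, huv, huvU⟩ := hU.exists_Ioo_subset hUne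
  have hper : ∀ x ∈ Ioo u v, x ∉ Function.periodicPts f := fun x hx h =>
    (hUper ▸ (⟨huvU hx, h⟩ : x ∈ U ∩ Function.periodicPts f) : x ∈ (∅ : Set _))
  have hcons : Conservative f μ := (MeasurePreserving.mk hf.measurable hinv).conservative
  obtain ⟨x, hx, hrec⟩ : ∃ x ∈ Ioo u v, ∀ s ∈ 𝓝 x, ∃ᶠ n in atTop, f^[n] x ∈ s := by
    have hne : μ (Ioo u v) ≠ 0 := (hpos _ isOpen_Ioo (nonempty_Ioo.2 huv)).ne'
    by_contra! h
    exact hne (measure_mono_null (fun x hx => show ¬ _ from fun hall => by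
      obtain ⟨s, hs, hs'⟩ := h x hx
      exact hall s hs hs') (ae_iff.1 hcons.ae_frequently_mem_of_mem_nhds))
  obtain ⟨n, hn, hnx⟩ := (frequently_atTop.1 (hrec _ (isOpen_Ioo.mem_nhds hx))) 1
  have hnmul : ∀ k, 0 < k → ∃ i j, n * (i + 1) = k * (j + 1) := fun k hk =>
    ⟨k - 1, n - 1, by rw [Nat.sub_add_cancel hk, Nat.sub_add_cancel hn, mul_comm]⟩
  have hreturn : ∀ s ∈ 𝓝 x, ∃ k, 0 < k ∧ f^[k] (f^[n] x) ∈ s := fun s hs => by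
    obtain ⟨m, hm, hmx⟩ := (frequently_atTop.1 (hrec s hs)) (n + 1)
    exact ⟨m - n, by omega, by rwa [← Function.iterate_add_apply, Nat.sub_add_cancel (by omega)]⟩
  rcases lt_trichotomy x (f^[n] x) with hlt | heq | hlt
  · obtain ⟨k, hk, hkx⟩ := hreturn _ ((isOpen_Ioo.inter isOpen_Iio).mem_nhds ⟨hx, hlt⟩)
    obtain ⟨i, j, hij⟩ := hnmul k hk
    have h₁ := lt_iterate_mul hf isPreconnected_Ioo hper hx hnx hlt i hx
    have h₂ := lt_iterate_mul (X := unitIntervalᵒᵈ) (f := f) hf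
      (isPreconnected_Ioo (α := unitInterval) (a := u) (b := v)) hper hnx hkx.1 hkx.2 j hx
    rw [hij] at h₁
    exact lt_asymm h₁ h₂
  · exact hper x hx ⟨n, hn, heq.symm⟩
  · obtain ⟨k, hk, hkx⟩ := hreturn _ ((isOpen_Ioo.inter isOpen_Ioi).mem_nhds ⟨hx, hlt⟩)
    obtain ⟨i, j, hij⟩ := hnmul k hk
    have h₁ := lt_iterate_mul (X := unitIntervalᵒᵈ) (f := f) hf
      (isPreconnected_Ioo (α := unitInterval) (a := u) (b := v)) hper hx hnx hlt i hx
    have h₂ := lt_iterate_mul hf isPreconnected_Ioo hper hnx hkx.1 hkx.2 j hx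
    rw [hij] at h₁
    exact lt_asymm h₁ h₂

/-- A non-atomic probability measure of full support is carried to Lebesgue measure by its
distribution function. -/
lemma exists_homeomorph_map_eq_lebI {μ : Measure unitInterval} [IsProbabilityMeasure μ]
    (hatom : ∀ x, μ {x} = 0)
    (hpos : ∀ U : Set unitInterval, IsOpen U → U.Nonempty → 0 < μ U) :
    ∃ H : unitInterval ≃ₜ unitInterval, μ.map H = lebI := by
  have : NullSingletonClass μ := ⟨hatom⟩
  let F : unitInterval → unitInterval := fun x => ⟨μ.real (Iic x), by simp, measureReal_le_one⟩
  have hmono : StrictMono F := by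
    intro x y hxy
    refine Subtype.mk_lt_mk.2 ?_
    have hsplit : μ.real (Iic y) = μ.real (Iic x) + μ.real (Ioc x y) := by
      rw [← Iic_union_Ioc_eq_Iic hxy.le,
        measureReal_union (Iic_disjoint_Ioc le_rfl) measurableSet_Ioc]
    have : 0 < μ.real (Ioc x y) := by
      refine ENNReal.toReal_pos ?_ (measure_ne_top _ _)
      exact ((hpos _ isOpen_Ioo (nonempty_Ioo.2 hxy)).trans_le
        (measure_mono Ioo_subset_Ioc_self)).ne'
    linarith
  have hcont : Continuous F := by
    refine Continuous.subtype_mk (continuous_iff_continuousAt.2 fun x => ?_) _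
    have heq : (fun x => μ.real (Iic x)) = fun x => ∫ y, (Iic x).indicator 1 y ∂μ := by
      ext x
      rw [integral_indicator_one measurableSet_Iic]
    rw [heq]
    refine continuousAt_of_dominated (bound := fun _ => 1) (.of_forall fun x =>
      (measurable_one.indicator measurableSet_Iic).aestronglyMeasurable)
      (.of_forall fun x => .of_forall fun y => ?_) (integrable_const 1) ?_
    · exact (norm_indicator_le_norm_self _ _).trans (by simp)
    · have hne : ∀ᵐ y ∂μ, y ≠ x := by simp [ae_iff, hatom]
      filter_upwards [hne] with y hy
      rcases hy.lt_or_gt with h | h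
      · refine continuousAt_const.congr (f := fun _ => (1 : ℝ)) ?_
        filter_upwards [lt_mem_nhds h] with z hz
        simp [hz.le]
      · refine continuousAt_const.congr (f := fun _ => (0 : ℝ)) ?_
        filter_upwards [gt_mem_nhds h] with z hz
        simp [hz]
  have hsurj : Function.Surjective F := by
    intro y
    have h0 : F 0 = 0 := by
      ext
      have : Iic (0 : unitInterval) = {0} := Iic_bot
      simp [F, this, Measure.real, hatom]
    have h1 : F 1 = 1 := by
      ext
      have : Iic (1 : unitInterval) = univ := Iic_top
      simp [F, this]
    obtain ⟨x, -, hx⟩ := intermediate_value_Icc (zero_le_one' unitInterval) hcont.continuousOn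
      (by rw [h0, h1]; exact ⟨y.2.1, y.2.2⟩ : y ∈ Icc (F 0) (F 1))
    exact ⟨x, hx⟩
  let e : unitInterval ≃o unitInterval := hmono.orderIsoOfSurjective F hsurj
  refine ⟨e.toHomeomorph, ?_⟩
  have : IsProbabilityMeasure (μ.map e.toHomeomorph) :=
    Measure.isProbabilityMeasure_map e.toHomeomorph.continuous.aemeasurable
  refine Measure.ext_of_Iic _ (volume : Measure unitInterval) fun y => ?_
  obtain ⟨x, rfl⟩ := hsurj y
  rw [Measure.map_apply e.toHomeomorph.continuous.measurable measurableSet_Iic,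
    unitInterval.volume_Iic]
  have hpre : e.toHomeomorph ⁻¹' Iic (F x) = Iic x := by
    ext z
    exact hmono.le_iff_le
  rw [hpre]
  exact (ofReal_measureReal).symm

lemma perAll_eq_periodicPts (f : X → X) : PerAll f = Function.periodicPts f := by
  ext x
  simp [PerAll, FixSet, Function.periodicPts, Function.IsPeriodicPt, Function.IsFixedPt,
    Nat.succ_le_iff]

lemma map_eq_self_iff [MeasurableSpace X] {f : X → X} (hf : Measurable f) {μ : Measure X} :
    μ.map f = μ ↔ ∀ A, MeasurableSet A → μ (f ⁻¹' A) = μ A := by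
  rw [Measure.ext_iff]
  exact forall₂_congr fun A hA => by rw [Measure.map_apply hf hA]

theorem dense_periodic_tfae (f : unitInterval → unitInterval) (hf : Continuous f) :
    (Dense (PerAll f) ↔
      ∃ μ : Measure unitInterval, IsProbabilityMeasure μ ∧
        (∀ x : unitInterval, μ {x} = 0) ∧
        (∀ U : Set unitInterval, IsOpen U → U.Nonempty → 0 < μ U) ∧
        (∀ A : Set unitInterval, MeasurableSet A → μ (f ⁻¹' A) = μ A)) ∧
    (Dense (PerAll f) ↔
      ∃ H : unitInterval ≃ₜ unitInterval,
        ∀ A : Set unitInterval, MeasurableSet A →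
          lebI ((⇑H ∘ f ∘ ⇑H.symm) ⁻¹' A) = lebI A) := by
  have hiff : Dense (PerAll f) ↔
      ∃ μ : Measure unitInterval, IsProbabilityMeasure μ ∧
        (∀ x : unitInterval, μ {x} = 0) ∧
        (∀ U : Set unitInterval, IsOpen U → U.Nonempty → 0 < μ U) ∧
        (∀ A : Set unitInterval, MeasurableSet A → μ (f ⁻¹' A) = μ A) := by
    simp only [← map_eq_self_iff hf.measurable, perAll_eq_periodicPts]
    exact ⟨fun hd => exists_invariant_fullSupport hf.measurable fun U hU hne =>
      exists_invariant_pos hf hd hU hne,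
      fun ⟨μ, _, _, hpos, hinv⟩ => dense_periodicPts_of_invariant hf hpos hinv⟩
  refine ⟨hiff, hiff.trans ⟨?_, ?_⟩⟩
  · rintro ⟨μ, _, hatom, hpos, hinv⟩
    obtain ⟨H, hH⟩ := exists_homeomorph_map_eq_lebI hatom hpos
    refine ⟨H, fun A hA => ?_⟩
    have hHA : MeasurableSet (H ⁻¹' A) := H.continuous.measurable hA
    rw [← hH, Measure.map_apply H.continuous.measurable hA, Measure.map_apply
      H.continuous.measurable ((H.continuous.comp (hf.comp H.symm.continuous)).measurable hA),
      ← hinv _ hHA]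
    congr 1
    ext x
    simp
  · rintro ⟨H, hH⟩
    have hsymm := H.symm.continuous.measurable
    have hprob : IsProbabilityMeasure lebI :=
      inferInstanceAs (IsProbabilityMeasure (volume : Measure unitInterval))
    refine ⟨lebI.map H.symm, Measure.isProbabilityMeasure_map hsymm.aemeasurable, fun x => ?_,
      fun U hU hne => ?_, fun A hA => ?_⟩
    · rw [Measure.map_apply hsymm (measurableSet_singleton x)]
      have hx : (H.symm ⁻¹' {x}).Subsingleton :=
        subsingleton_singleton.preimage H.symm.injective
      exact hx.measure_zero (volume : Measure unitInterval)
    · rw [Measure.map_apply hsymm hU.measurableSet]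
      obtain ⟨u, v, huv, hsub⟩ := (hU.preimage H.symm.continuous).exists_Ioo_subset
        (hne.preimage H.symm.surjective)
      refine lt_of_lt_of_le ?_ (measure_mono hsub)
      change 0 < (volume : Measure unitInterval) (Ioo u v)
      simpa [unitInterval.volume_Ioo] using huv
    · rw [Measure.map_apply hsymm hA, Measure.map_apply hsymm (hf.measurable hA),
        ← hH _ (hsymm hA)]
      congr 1
      ext x
      simp
end
end
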